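/- (Factorizable eigenstate: the average adiabatic fake curvature equals the adiabatic curvature of the system.) Let ζ : U → H_S and ξ : U → H_E be twice continuously differentiable with ‖ζ(x)‖ = ‖ξ(x)‖ = 1 for all x ∈ U. For a direction u ∈ E define 𝒜(u)(x) = |D_uζ(x)⟩⟨ζ(x)| + ⟪ξ(x), D_uξ(x)⟫·|ζ(x)⟩⟨ζ(x)| and the reduced potential A(u)(x) = ( ⟪ζ(x), D_uζ(x)⟫ + ⟪ξ(x), D_uξ(x)⟫ )·|ζ(x)⟩⟨ζ(x)|, both operator-valued maps U → (H_S →L[ℂ] H_S). For directions u, v define B(u,v)(x₀) = D_u(𝒜(v))(x₀) − D_v(𝒜(u))(x₀) − [𝒜(u)(x₀), 𝒜(v)(x₀)] and the adiabatic fake curvature F(u,v)(x₀) = D_u(A(v))(x₀) − D_v(A(u))(x₀) − [A(u)(x₀), A(v)(x₀)] − B(u,v)(x₀), where [S,T] = S∘T − T∘S. Then for every x₀ ∈ U and all u, v ∈ E: Tr( |ζ(x₀)⟩⟨ζ(x₀)| ∘ F(u,v)(x₀) ) = D_u(x ↦ ⟪ζ(x), D_vζ(x)⟫)(x₀) − D_v(x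 ↦ ⟪ζ(x), D_uζ(x)⟫)(x₀). -/

import Mathlib

open scoped ComplexInnerProductSpace

/-- `|v⟩⟨w|` as an operator: `z ↦ ⟪w, z⟫ • v`. -/
noncomputable def ketbraOp {H : Type*} [NormedAddCommGroup H] [InnerProductSpace ℂ H]
    (v w : H) : H →L[ℂ] H :=
  (innerSL ℂ w).smulRight v

section Ketbra

variable {H : Type*} [NormedAddCommGroup H] [InnerProductSpace ℂ H]

theorem ketbraOp_apply (v w z : H) : ketbraOp v w z = ⟪w, z⟫ • v := by
  simp [ketbraOp]

theorem isBoundedBilinearMap_ketbraOp :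
    IsBoundedBilinearMap ℝ (fun p : H × H => ketbraOp p.1 p.2) where
  add_left v₁ v₂ w := by
    ext z
    simp [ketbraOp_apply]
  smul_left c v w := by
    ext z
    simp [ketbraOp_apply, smul_comm c]
  add_right v w₁ w₂ := by
    ext z
    simp [ketbraOp_apply, add_smul]
  smul_right c v w := by
    ext z
    simp [ketbraOp_apply, inner_smul_left_eq_smul, mul_smul]
  bound := ⟨1, one_pos, fun v w => by simp [ketbraOp, mul_comm]⟩

theorem trace_ketbraOp_comp [FiniteDimensional ℂ H] (v w : H) (T : H →L[ℂ] H) :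
    LinearMap.trace ℂ H ((ketbraOp v w ∘L T : H →L[ℂ] H) : H →ₗ[ℂ] H) = ⟪w, T v⟫ := by
  have h : ((ketbraOp v w ∘L T : H →L[ℂ] H) : H →ₗ[ℂ] H)
      = ((innerSL ℂ w ∘L T : H →L[ℂ] ℂ) : H →ₗ[ℂ] ℂ).smulRight v := by
    ext z
    simp [ketbraOp_apply]
  rw [h, LinearMap.trace_smulRight]
  simp

variable {E : Type*} [NormedAddCommGroup E] [NormedSpace ℝ E]

theorem DifferentiableAt.ketbraOp {f g : E → H} {x : E} (hf : DifferentiableAt ℝ f x)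
    (hg : DifferentiableAt ℝ g x) : DifferentiableAt ℝ (fun y => ketbraOp (f y) (g y)) x :=
  DifferentiableAt.comp (g := fun p : H × H => _root_.ketbraOp p.1 p.2) x
    (isBoundedBilinearMap_ketbraOp.differentiableAt (f x, g x)) (hf.prodMk hg)

theorem fderiv_ketbraOp_apply {f g : E → H} {x : E} (hf : DifferentiableAt ℝ f x)
    (hg : DifferentiableAt ℝ g x) (u : E) :
    fderiv ℝ (fun y => ketbraOp (f y) (g y)) x u
      = ketbraOp (f x) (fderiv ℝ g x u) + ketbraOp (fderiv ℝ f x u) (g x) := by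
  have h := (isBoundedBilinearMap_ketbraOp.hasFDerivAt (f x, g x)).comp x
    (hf.hasFDerivAt.prodMk hg.hasFDerivAt)
  have h' := h.fderiv
  simp only [Function.comp_def] at h'
  rw [h']
  simp

end Ketbra

theorem inner_fderiv_add_inner_fderiv_eq_zero
    {E : Type*} [NormedAddCommGroup E] [NormedSpace ℝ E]
    {H : Type*} [NormedAddCommGroup H] [InnerProductSpace ℂ H]
    {U : Set E} (hU : IsOpen U) {x : E} (hx : x ∈ U) {f : E → H} (hf : DifferentiableAt ℝ f x)
    (hn : ∀ y ∈ U, ‖f y‖ = 1) (u : E) :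
    ⟪f x, fderiv ℝ f x u⟫ + ⟪fderiv ℝ f x u, f x⟫ = 0 := by
  rw [← fderiv_inner_apply ℂ hf hf]
  have h : (fun y => ⟪f y, f y⟫) =ᶠ[nhds x] fun _ => (1 : ℂ) := by
    filter_upwards [hU.mem_nhds hx] with y hy
    simp [inner_self_eq_norm_sq_to_K, hn y hy]
  rw [h.fderiv_eq]
  simp

/-- factorizable eigenstate: the average adiabatic fake curvature
`Tr(|ζ⟩⟨ζ| ∘ F(u,v))` equals the adiabatic curvature of the system
`D_u⟪ζ, D_vζ⟫ − D_v⟪ζ, D_uζ⟫`, where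
`𝒜(u)(x) = |D_uζ(x)⟩⟨ζ(x)| + ⟪ξ(x), D_uξ(x)⟫·|ζ(x)⟩⟨ζ(x)|`,
`A(u)(x) = (⟪ζ(x), D_uζ(x)⟫ + ⟪ξ(x), D_uξ(x)⟫)·|ζ(x)⟩⟨ζ(x)|`,
`B(u,v) = D_u𝒜(v) − D_v𝒜(u) − [𝒜(u), 𝒜(v)]` and
`F(u,v) = D_uA(v) − D_vA(u) − [A(u), A(v)] − B(u,v)`. -/
theorem stmt_11
    {E : Type*} [NormedAddCommGroup E] [NormedSpace ℝ E]
    {HS : Type*} [NormedAddCommGroup HS] [InnerProductSpace ℂ HS] [FiniteDimensional ℂ HS]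
    {HE : Type*} [NormedAddCommGroup HE] [InnerProductSpace ℂ HE] [FiniteDimensional ℂ HE]
    (U : Set E) (hU : IsOpen U) (x₀ : E) (hx₀ : x₀ ∈ U)
    (ζ : E → HS) (ξ : E → HE)
    (hζ : ContDiffOn ℝ 2 ζ U) (hξ : ContDiffOn ℝ 2 ξ U)
    (hζn : ∀ x ∈ U, ‖ζ x‖ = 1) (hξn : ∀ x ∈ U, ‖ξ x‖ = 1)
    (A : E → E → (HS →L[ℂ] HS)) (Ared : E → E → (HS →L[ℂ] HS))
    (hA : ∀ u : E, ∀ x ∈ U,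
      A u x = ketbraOp (fderiv ℝ ζ x u) (ζ x)
                + ⟪ξ x, fderiv ℝ ξ x u⟫ • ketbraOp (ζ x) (ζ x))
    (hAred : ∀ u : E, ∀ x ∈ U,
      Ared u x = (⟪ζ x, fderiv ℝ ζ x u⟫ + ⟪ξ x, fderiv ℝ ξ x u⟫) • ketbraOp (ζ x) (ζ x))
    (u v : E) :
    LinearMap.trace ℂ HS
        ((ketbraOp (ζ x₀) (ζ x₀) ∘L
          ((fderiv ℝ (Ared v) x₀ u - fderiv ℝ (Ared u) x₀ v
              - (Ared u x₀ ∘L Ared v x₀ - Ared v x₀ ∘L Ared u x₀))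
            - (fderiv ℝ (A v) x₀ u - fderiv ℝ (A u) x₀ v
                - (A u x₀ ∘L A v x₀ - A v x₀ ∘L A u x₀))) : HS →L[ℂ] HS) : HS →ₗ[ℂ] HS)
      = fderiv ℝ (fun x => ⟪ζ x, fderiv ℝ ζ x v⟫) x₀ u
          - fderiv ℝ (fun x => ⟪ζ x, fderiv ℝ ζ x u⟫) x₀ v := by
  have hUn := hU.mem_nhds hx₀
  have hζ₀ : ContDiffAt ℝ 2 ζ x₀ := hζ.contDiffAt hUn
  have hξ₀ : ContDiffAt ℝ 2 ξ x₀ := hξ.contDiffAt hUn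
  have dζ : DifferentiableAt ℝ ζ x₀ := hζ₀.differentiableAt (by norm_num)
  have dξ : DifferentiableAt ℝ ξ x₀ := hξ₀.differentiableAt (by norm_num)
  have d2ζ : DifferentiableAt ℝ (fderiv ℝ ζ) x₀ :=
    (hζ₀.fderiv_right (m := 1) (by norm_num)).differentiableAt (by norm_num)
  have d2ξ : DifferentiableAt ℝ (fderiv ℝ ξ) x₀ :=
    (hξ₀.fderiv_right (m := 1) (by norm_num)).differentiableAt (by norm_num)
  have dζw (w : E) : DifferentiableAt ℝ (fun x => fderiv ℝ ζ x w) x₀ :=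
    d2ζ.clm_apply (differentiableAt_const w)
  have dξw (w : E) : DifferentiableAt ℝ (fun x => fderiv ℝ ξ x w) x₀ :=
    d2ξ.clm_apply (differentiableAt_const w)
  have dc (w : E) : DifferentiableAt ℝ (fun x => ⟪ξ x, fderiv ℝ ξ x w⟫) x₀ :=
    dξ.inner ℂ (dξw w)
  have db (w : E) : DifferentiableAt ℝ (fun x => ⟪ζ x, fderiv ℝ ζ x w⟫) x₀ :=
    dζ.inner ℂ (dζw w)
  have dP : DifferentiableAt ℝ (fun x => ketbraOp (ζ x) (ζ x)) x₀ := dζ.ketbraOp dζ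
  have hskew (w : E) : ⟪fderiv ℝ ζ x₀ w, ζ x₀⟫ = -⟪ζ x₀, fderiv ℝ ζ x₀ w⟫ :=
    eq_neg_of_add_eq_zero_right
      (inner_fderiv_add_inner_fderiv_eq_zero hU hx₀ dζ hζn w)
  have hone : ⟪ζ x₀, ζ x₀⟫ = 1 := by
    simp [inner_self_eq_norm_sq_to_K, hζn x₀ hx₀]
  have hfA (s t : E) : fderiv ℝ (A t) x₀ s
      = ketbraOp (fderiv ℝ ζ x₀ t) (fderiv ℝ ζ x₀ s)
        + ketbraOp (fderiv ℝ (fun x => fderiv ℝ ζ x t) x₀ s) (ζ x₀)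
        + (⟪ξ x₀, fderiv ℝ ξ x₀ t⟫ •
            (ketbraOp (ζ x₀) (fderiv ℝ ζ x₀ s) + ketbraOp (fderiv ℝ ζ x₀ s) (ζ x₀))
          + fderiv ℝ (fun x => ⟪ξ x, fderiv ℝ ξ x t⟫) x₀ s • ketbraOp (ζ x₀) (ζ x₀)) := by
    rw [(Filter.eventuallyEq_of_mem hUn (hA t)).fderiv_eq,
      fderiv_fun_add ((dζw t).ketbraOp dζ) ((dc t).fun_smul dP), fderiv_fun_smul (dc t) dP]
    simp [fderiv_ketbraOp_apply, dζw t, dζ]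
  have hfAred (s t : E) : fderiv ℝ (Ared t) x₀ s
      = (⟪ζ x₀, fderiv ℝ ζ x₀ t⟫ + ⟪ξ x₀, fderiv ℝ ξ x₀ t⟫) •
            (ketbraOp (ζ x₀) (fderiv ℝ ζ x₀ s) + ketbraOp (fderiv ℝ ζ x₀ s) (ζ x₀))
        + (fderiv ℝ (fun x => ⟪ζ x, fderiv ℝ ζ x t⟫) x₀ s
          + fderiv ℝ (fun x => ⟪ξ x, fderiv ℝ ξ x t⟫) x₀ s) • ketbraOp (ζ x₀) (ζ x₀) := by
    rw [(Filter.eventuallyEq_of_mem hUn (hAred t)).fderiv_eq,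
      fderiv_fun_smul ((db t).fun_add (dc t)) dP, fderiv_fun_add (db t) (dc t)]
    simp [fderiv_ketbraOp_apply, dζ]
  have hsymm : fderiv ℝ (fun x => fderiv ℝ ζ x v) x₀ u
      = fderiv ℝ (fun x => fderiv ℝ ζ x u) x₀ v := by
    have h := (hζ₀.isSymmSndFDerivAt (by simp)).eq u v
    rw [fderiv_clm_apply d2ζ (differentiableAt_const v),
      fderiv_clm_apply d2ζ (differentiableAt_const u)]
    simpa using h
  rw [trace_ketbraOp_comp, hfA u v, hfA v u, hfAred u v, hfAred v u, hsymm,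
    hA u x₀ hx₀, hA v x₀ hx₀, hAred u x₀ hx₀, hAred v x₀ hx₀]
  simp only [sub_apply, add_apply,
    smul_apply, ContinuousLinearMap.comp_apply, ketbraOp_apply,
    inner_sub_right, inner_add_right, inner_smul_right, hone, hskew]
  ring
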